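/- arXiv:1607.06165 — 2 statements merged into one kernel-verified Lean document; each statement's English description precedes it below -/
import Mathlib

section
/- Let (X,d) and (Λ,ρ) be compact metric spaces, ω : Λ × X → X continuous, p a Borel probability measure on Λ, and ℙ = p^ℕ on Ω = Λ^ℕ. Define S = {σ ∈ Ω : lim_{n→∞} diam(ω_{σ_1} ∘ ⋯ ∘ ω_{σ_n}(X)) = 0} and F = {σ ∈ Ω : lim_{n→∞} (1/n) Σ_{i=1}^n diam(ω_{σ_i} ∘ ⋯ ∘ ω_{σ_1}(X)) = 0}. Then ℙ(F) = 1 if and only if ℙ(S) = 1. -/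
open Metric Set Filter MeasureTheory

def hcomp {Λ X : Type*} (ω : Λ → X → X) (σ : ℕ → Λ) : ℕ → X → X
  | 0 => id
  | n + 1 => hcomp ω σ n ∘ ω (σ n)

def fcomp {Λ X : Type*} (ω : Λ → X → X) (σ : ℕ → Λ) : ℕ → X → X
  | 0 => id
  | n + 1 => ω (σ n) ∘ fcomp ω σ n

def IsBernoulli {Λ : Type*} [MeasurableSpace Λ]
    (p : Measure Λ) (P : Measure (ℕ → Λ)) : Prop :=
  IsProbabilityMeasure P ∧
    ∀ (n : ℕ) (A : ℕ → Set Λ), (∀ i, MeasurableSet (A i)) →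
      P {σ | ∀ i < n, σ i ∈ A i} = ∏ i ∈ Finset.range n, p (A i)

/-- The set `S` of sequences along which the forward images have diameters tending to `0`. -/
def Sset {Λ X : Type*} [MetricSpace X] (ω : Λ → X → X) : Set (ℕ → Λ) :=
  {σ | Tendsto (fun n : ℕ => Metric.diam (Set.range (hcomp ω σ n))) atTop (nhds 0)}

/-- The set `F` of sequences along which the Cesàro averages of the diameters
`diam (ω_{σ_i} ∘ ⋯ ∘ ω_{σ_1}(X))` tend to `0`. -/
def Fset {Λ X : Type*} [MetricSpace X] (ω : Λ → X → X) : Set (ℕ → Λ) :=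
  {σ | Tendsto (fun n : ℕ => ((n : ℝ))⁻¹ *
      ∑ i ∈ Finset.range n, Metric.diam (Set.range (fcomp ω σ (i + 1))))
    atTop (nhds 0)}

section Compositions

variable {Λ X : Type*} (ω : Λ → X → X)

lemma fcomp_congr {σ τ : ℕ → Λ} (n : ℕ) (h : ∀ i < n, σ i = τ i) :
    fcomp ω σ n = fcomp ω τ n := by
  induction n with
  | zero => rfl
  | succ n ih => simp only [fcomp]; rw [h n (by omega), ih fun i hi => h i (by omega)]

lemma fcomp_add (σ : ℕ → Λ) (m k : ℕ) :
    fcomp ω σ (m + k) = fcomp ω (fun i => σ (i + m)) k ∘ fcomp ω σ m := by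
  induction k with
  | zero => rfl
  | succ k ih =>
    rw [← add_assoc]
    simp only [fcomp]
    rw [ih, add_comm m k]
    rfl

lemma fcomp_succ' (σ : ℕ → Λ) (n : ℕ) :
    fcomp ω σ (n + 1) = fcomp ω (fun i => σ (i + 1)) n ∘ ω (σ 0) := by
  rw [add_comm, fcomp_add]; rfl

lemma hcomp_eq_fcomp (σ τ : ℕ → Λ) (n : ℕ) (h : ∀ i < n, τ i = σ (n - 1 - i)) :
    hcomp ω σ n = fcomp ω τ n := by
  induction n generalizing τ with
  | zero => rfl
  | succ n ih =>
    rw [fcomp_succ', hcomp, ih (fun i => τ (i + 1)), h 0 (by omega)]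
    · simp
    · intro i hi
      rw [h (i + 1) (by omega)]
      congr 1
      omega

/-- The permutation of `ℕ` reversing the first `n` integers. -/
def revPrefix (n i : ℕ) : ℕ := if i < n then n - 1 - i else i

lemma revPrefix_injective (n : ℕ) : Function.Injective (revPrefix n) := by
  intro i j h
  unfold revPrefix at h
  split_ifs at h <;> omega

lemma hcomp_eq_fcomp_revPrefix (σ : ℕ → Λ) (n : ℕ) :
    hcomp ω σ n = fcomp ω (fun i => σ (revPrefix n i)) n :=
  hcomp_eq_fcomp ω _ _ _ fun i hi => by simp [revPrefix, hi]

variable [MetricSpace X] [CompactSpace X]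

lemma diam_le_diam_univ (s : Set X) : Metric.diam s ≤ Metric.diam (Set.univ : Set X) :=
  Metric.diam_mono (Set.subset_univ s) isCompact_univ.isBounded

lemma diam_hcomp_antitone (σ : ℕ → Λ) :
    Antitone fun n => Metric.diam (Set.range (hcomp ω σ n)) :=
  antitone_nat_of_succ_le fun _ =>
    Metric.diam_mono (Set.range_comp_subset_range _ _) (Metric.isBounded_of_compactSpace)

lemma diam_fcomp_add_le (σ : ℕ → Λ) (m k : ℕ) :
    Metric.diam (Set.range (fcomp ω σ (m + k))) ≤
      Metric.diam (Set.range (fcomp ω (fun i => σ (i + m)) k)) := by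
  rw [fcomp_add]
  exact Metric.diam_mono (Set.range_comp_subset_range _ _) (Metric.isBounded_of_compactSpace)

end Compositions

section Measurability

variable {Λ X : Type*} (ω : Λ → X → X) [MetricSpace X] [MetricSpace Λ]

lemma continuous_fcomp_apply (hω : Continuous fun q : Λ × X => ω q.1 q.2) (n : ℕ) (x : X) :
    Continuous fun σ : ℕ → Λ => fcomp ω σ n x := by
  induction n with
  | zero => exact continuous_const
  | succ n ih => exact hω.comp ((continuous_apply n).prodMk ih)

variable [CompactSpace Λ] [MeasurableSpace Λ] [BorelSpace Λ]

lemma measurable_diam_fcomp (hω : Continuous fun q : Λ × X => ω q.1 q.2) (n : ℕ) :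
    Measurable fun σ : ℕ → Λ => Metric.diam (Set.range (fcomp ω σ n)) := by
  have h : Measurable fun σ : ℕ → Λ => ⨆ x, ⨆ y, edist (fcomp ω σ n x) (fcomp ω σ n y) :=
    (lowerSemicontinuous_iSup fun x => lowerSemicontinuous_iSup fun y =>
      ((continuous_fcomp_apply ω hω n x).edist
        (continuous_fcomp_apply ω hω n y)).lowerSemicontinuous).measurable
  convert h.ennreal_toReal using 2 with σ
  simp only [Metric.diam, Metric.ediam, iSup_range]

lemma measurable_diam_hcomp (hω : Continuous fun q : Λ × X => ω q.1 q.2) (n : ℕ) :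
    Measurable fun σ : ℕ → Λ => Metric.diam (Set.range (hcomp ω σ n)) := by
  simp only [hcomp_eq_fcomp_revPrefix]
  exact (measurable_diam_fcomp ω hω n).comp
    (measurable_pi_lambda _ fun i => measurable_pi_apply _)

end Measurability

section ProductMeasure

variable {Λ : Type*} [MeasurableSpace Λ] {p : Measure Λ} [IsProbabilityMeasure p]

lemma IsBernoulli.eq_infinitePi {P : Measure (ℕ → Λ)} (hP : IsBernoulli p P) :
    P = Measure.infinitePi fun _ => p := by
  classical
  refine Measure.eq_infinitePi _ fun s t ht => ?_
  obtain ⟨n, hn⟩ := s.exists_nat_subset_range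
  have h := hP.2 n (fun i => if i ∈ s then t i else Set.univ)
    fun i => by split_ifs <;> simp [ht]
  have h1 : {σ : ℕ → Λ | ∀ i < n, σ i ∈ (if i ∈ s then t i else Set.univ)} = (s : Set ℕ).pi t := by
    ext σ
    simp only [Set.mem_ofPred_eq, Set.mem_pi, Finset.mem_coe]
    refine ⟨fun H i hi => by simpa [hi] using H i (by simpa using hn hi), fun H i _ => ?_⟩
    split_ifs with hi
    exacts [H i hi, Set.mem_univ _]
  rw [h1] at h
  rw [h, ← Finset.prod_subset hn fun i _ hi => by simp [hi]]
  exact Finset.prod_congr rfl fun i hi => by simp [hi]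

lemma measurePreserving_reindex {f : ℕ → ℕ} (hf : Function.Injective f) :
    MeasurePreserving (fun (σ : ℕ → Λ) i => σ (f i))
      (Measure.infinitePi fun _ => p) (Measure.infinitePi fun _ => p) :=
  ⟨by fun_prop, Measure.map_infinitePi_infinitePi_of_inj (P := fun _ : ℕ => p) hf⟩

lemma indepFun_windows {g : (ℕ → Λ) → ℝ} (hg : Measurable g) {k : ℕ}
    (hdep : ∀ σ τ : ℕ → Λ, (∀ i < k, σ i = τ i) → g σ = g τ) {a b : ℕ} (hab : a + k ≤ b) :
    ProbabilityTheory.IndepFun (fun σ : ℕ → Λ => g fun i => σ (i + a))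
      (fun σ => g fun i => σ (i + b)) (Measure.infinitePi fun _ => p) := by
  classical
  obtain ⟨c⟩ : Nonempty Λ := nonempty_of_isProbabilityMeasure p
  have hi : ProbabilityTheory.iIndepFun (fun (i : ℕ) (σ : ℕ → Λ) => σ i)
      (Measure.infinitePi fun _ => p) :=
    ProbabilityTheory.iIndepFun_infinitePi (X := fun _ x => x) fun _ => measurable_id
  have hdisj : Disjoint (Finset.Ico a (a + k)) (Finset.Ico b (b + k)) := by
    rw [Finset.disjoint_left]
    intro i h1 h2
    rw [Finset.mem_Ico] at h1 h2
    omega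
  let e (d : ℕ) (u : Finset.Ico d (d + k) → Λ) (i : ℕ) : Λ :=
    if h : i + d ∈ Finset.Ico d (d + k) then u ⟨i + d, h⟩ else c
  have he (d : ℕ) : Measurable (e d) := by
    refine measurable_pi_lambda _ fun i => ?_
    by_cases h : i + d ∈ Finset.Ico d (d + k)
    · simpa only [e, h, dif_pos] using measurable_pi_apply _
    · simpa only [e, h, dif_neg, not_false_eq_true] using measurable_const
  have hge (d : ℕ) : (fun σ : ℕ → Λ => g fun i => σ (i + d)) =
      (g ∘ e d) ∘ fun σ (i : Finset.Ico d (d + k)) => σ i := by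
    funext σ
    refine hdep _ _ fun i hi => ?_
    have h : i + d ∈ Finset.Ico d (d + k) := by rw [Finset.mem_Ico]; omega
    simp only [e, h, dif_pos]
  rw [hge a, hge b]
  exact (hi.indepFun_finset _ _ hdisj fun i => measurable_pi_apply i).comp
    (hg.comp (he a)) (hg.comp (he b))

lemma ae_tendsto_average_windows {g : (ℕ → Λ) → ℝ} (hg : Measurable g)
    (hint : Integrable g (Measure.infinitePi fun _ => p)) {k : ℕ}
    (hdep : ∀ σ τ : ℕ → Λ, (∀ i < k, σ i = τ i) → g σ = g τ) (r : ℕ) :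
    ∀ᵐ σ ∂(Measure.infinitePi fun _ => p),
      Tendsto (fun m : ℕ => (∑ j ∈ Finset.range m, g fun i => σ (i + (j * k + r))) / m)
        atTop (nhds (∫ σ, g σ ∂(Measure.infinitePi fun _ => p))) := by
  have hmp (d : ℕ) := measurePreserving_reindex (p := p) (add_left_injective d)
  have hid (d : ℕ) : ProbabilityTheory.IdentDistrib (fun σ : ℕ → Λ => g fun i => σ (i + d)) g
      (Measure.infinitePi fun _ => p) (Measure.infinitePi fun _ => p) :=
    ⟨(hg.comp (hmp d).measurable).aemeasurable, hg.aemeasurable, by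
      conv_rhs => rw [← (hmp d).map_eq]
      rw [Measure.map_map hg (hmp d).measurable]
      rfl⟩
  have := ProbabilityTheory.strong_law_ae_real
    (fun j (σ : ℕ → Λ) => g fun i => σ (i + (j * k + r)))
    ((hid _).integrable_iff.2 hint) ?_ (fun j => (hid _).trans (hid _).symm)
  · rwa [(hid _).integral_eq] at this
  · have key {i j : ℕ} (h : i < j) : i * k + r + k ≤ j * k + r := by
      have := Nat.mul_le_mul_right k h
      rw [Nat.succ_mul] at this
      omega
    intro i j hij
    rcases lt_or_gt_of_ne hij with h | h
    · exact indepFun_windows hg hdep (key h)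
    · exact (indepFun_windows hg hdep (key h)).symm

end ProductMeasure

section Averages

lemma sum_range_mul_eq_sum_residues (x : ℕ → ℝ) (m k : ℕ) :
    ∑ i ∈ Finset.range (m * k), x i =
      ∑ r ∈ Finset.range k, ∑ j ∈ Finset.range m, x (j * k + r) := by
  rw [Finset.sum_comm]
  induction m with
  | zero => simp
  | succ m ih => rw [Nat.succ_mul, Finset.sum_range_add, ih, Finset.sum_range_succ]

lemma eventually_average_lt_of_residues {x : ℕ → ℝ} (hx : ∀ i, 0 ≤ x i) {k : ℕ} (hk : 0 < k)
    {a b : ℝ} (hab : 2 * a < b)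
    (h : ∀ r, Tendsto (fun m : ℕ => (∑ j ∈ Finset.range m, x (j * k + r)) / m) atTop (nhds a)) :
    ∀ᶠ n : ℕ in atTop, (n : ℝ)⁻¹ * ∑ i ∈ Finset.range n, x i < b := by
  have hk' : (0 : ℝ) < k := by exact_mod_cast hk
  have h1 : Tendsto (fun m : ℕ => (∑ i ∈ Finset.range (m * k), x i) / m) atTop (nhds (k * a)) := by
    simp only [sum_range_mul_eq_sum_residues, Finset.sum_div]
    simpa [Finset.sum_div] using tendsto_finsetSum (Finset.range k) fun r _ => h r
  have h2 : ∀ᶠ m : ℕ in atTop, (∑ i ∈ Finset.range (m * k), x i) / m < k * (b / 2) :=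
    h1.eventually_lt_const (by gcongr; linarith)
  have h3 : Tendsto (fun n : ℕ => n / k + 1) atTop atTop :=
    (tendsto_add_atTop_nat 1).comp (Nat.tendsto_div_const_atTop hk.ne')
  filter_upwards [h3.eventually h2, eventually_ge_atTop k] with n hn hkn
  have hn0 : (0 : ℝ) < n := by exact_mod_cast hk.trans_le hkn
  have hsub : ∑ i ∈ Finset.range n, x i ≤ ∑ i ∈ Finset.range ((n / k + 1) * k), x i :=
    Finset.sum_le_sum_of_subset_of_nonneg
      (Finset.range_mono (by have := Nat.lt_div_mul_add (a := n) hk; rw [add_mul]; omega))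
      fun i _ _ => hx i
  have hm : ((n / k + 1 : ℕ) : ℝ) * k ≤ 2 * n := by
    have : (n / k + 1) * k ≤ 2 * n := by have := Nat.div_mul_le_self n k; rw [add_mul]; omega
    exact_mod_cast this
  have hm0 : (0 : ℝ) < (n / k + 1 : ℕ) := by positivity
  have hb : 0 ≤ b / 2 := by
    have h0 : 0 ≤ a := ge_of_tendsto' (h 0) fun m =>
      div_nonneg (Finset.sum_nonneg fun i _ => hx _) m.cast_nonneg
    linarith
  rw [div_lt_iff₀ hm0] at hn
  rw [inv_mul_lt_iff₀ hn0]
  nlinarith [mul_le_mul_of_nonneg_right hm hb]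

lemma tendsto_average_zero_of_window_bounds {y : ℕ → ℝ} {x : ℕ → ℕ → ℝ} {a : ℕ → ℝ} {C : ℝ}
    (hy : ∀ i, 0 ≤ y i) (hyC : ∀ i, y i ≤ C) (hx : ∀ k i, 0 ≤ x k i)
    (hyx : ∀ k i, y (k + i) ≤ x k i) (ha : Tendsto a atTop (nhds 0))
    (h : ∀ k r, Tendsto (fun m : ℕ => (∑ j ∈ Finset.range m, x k (j * (k + 1) + r)) / m)
      atTop (nhds (a k))) :
    Tendsto (fun n : ℕ => (n : ℝ)⁻¹ * ∑ i ∈ Finset.range n, y i) atTop (nhds 0) := by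
  refine tendsto_order.2 ⟨fun b hb => .of_forall fun n => hb.trans_le ?_, fun ε hε => ?_⟩
  · exact mul_nonneg (by positivity) (Finset.sum_nonneg fun i _ => hy i)
  obtain ⟨k, hk⟩ := (ha.eventually_lt_const (show (0 : ℝ) < ε / 4 by linarith)).exists
  have h1 := eventually_average_lt_of_residues (hx k) k.succ_pos
    (show 2 * a k < ε / 2 by linarith) (h k)
  have h2 : Tendsto (fun n : ℕ => (n : ℝ)⁻¹ * (k * C)) atTop (nhds 0) := by
    simpa using (tendsto_inv_atTop_nhds_zero_nat (𝕜 := ℝ)).mul_const (k * C)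
  filter_upwards [h1, h2.eventually_lt_const (show (0 : ℝ) < ε / 2 by linarith)] with n hn1 hn2
  have hsum : ∑ i ∈ Finset.range n, y i ≤ k * C + ∑ i ∈ Finset.range n, x k i :=
    calc ∑ i ∈ Finset.range n, y i ≤ ∑ i ∈ Finset.range (k + n), y i :=
          Finset.sum_le_sum_of_subset_of_nonneg (Finset.range_mono (by omega)) fun i _ _ => hy i
      _ = ∑ i ∈ Finset.range k, y i + ∑ i ∈ Finset.range n, y (k + i) := Finset.sum_range_add ..
      _ ≤ k * C + ∑ i ∈ Finset.range n, x k i := by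
          refine add_le_add ?_ (Finset.sum_le_sum fun i _ => hyx k i)
          simpa using Finset.sum_le_card_nsmul (Finset.range k) y C fun i _ => hyC i
  have := mul_le_mul_of_nonneg_left hsum (inv_nonneg.2 (n.cast_nonneg (α := ℝ)))
  rw [mul_add] at this
  linarith

lemma Antitone.le_average {a : ℕ → ℝ} (ha : Antitone a) {n : ℕ} (hn : 0 < n) :
    a n ≤ (n : ℝ)⁻¹ * ∑ i ∈ Finset.range n, a (i + 1) := by
  rw [le_inv_mul_iff₀ (by exact_mod_cast hn)]
  simpa using Finset.card_nsmul_le_sum (Finset.range n) (fun i => a (i + 1)) (a n)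
    fun i hi => ha (by simpa using hi)

/-- An antitone sequence of bounded nonnegative functions tends to zero almost everywhere
iff its integrals tend to zero. -/
lemma ae_tendsto_zero_iff_of_antitone {Ω : Type*} [MeasurableSpace Ω] {μ : Measure Ω}
    [IsFiniteMeasure μ] {f : ℕ → Ω → ℝ} {C : ℝ} (hf : ∀ n, Measurable (f n))
    (h0 : ∀ n x, 0 ≤ f n x) (hC : ∀ n x, f n x ≤ C) (hanti : ∀ x, Antitone fun n => f n x) :
    (∀ᵐ x ∂μ, Tendsto (fun n => f n x) atTop (nhds 0)) ↔
      Tendsto (fun n => ∫ x, f n x ∂μ) atTop (nhds 0) := by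
  have hdct {g : Ω → ℝ} (hg : ∀ᵐ x ∂μ, Tendsto (fun n => f n x) atTop (nhds (g x))) :
      Tendsto (fun n => ∫ x, f n x ∂μ) atTop (nhds (∫ x, g x ∂μ)) :=
    tendsto_integral_of_dominated_convergence (fun _ => C)
      (fun n => (hf n).aestronglyMeasurable) (integrable_const C)
      (fun n => .of_forall fun x => by
        rw [Real.norm_of_nonneg (h0 n x)]; exact hC n x) hg
  refine ⟨fun h => by simpa using hdct h, fun h => ?_⟩
  have hlim (x : Ω) : Tendsto (fun n => f n x) atTop (nhds (⨅ n, f n x)) :=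
    tendsto_atTop_ciInf (hanti x) ⟨0, by rintro _ ⟨n, rfl⟩; exact h0 n x⟩
  have hL0 (x : Ω) : 0 ≤ ⨅ n, f n x := le_ciInf fun n => h0 n x
  have hLC (x : Ω) : ⨅ n, f n x ≤ C := le_of_tendsto' (hlim x) fun n => hC n x
  have hLint : Integrable (fun x => ⨅ n, f n x) μ :=
    .of_bound (Measurable.iInf hf).aestronglyMeasurable C (.of_forall fun x => by
      rw [Real.norm_of_nonneg (hL0 x)]; exact hLC x)
  have hzero := tendsto_nhds_unique h (hdct (.of_forall hlim))
  have := (integral_eq_zero_iff_of_nonneg hL0 hLint).1 hzero.symm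
  filter_upwards [this] with x hx
  have h' := hlim x
  rw [hx] at h'
  exact h'

end Averages

theorem stmt4 {X Λ : Type*} [MetricSpace X] [CompactSpace X]
    [MetricSpace Λ] [CompactSpace Λ] [MeasurableSpace Λ] [BorelSpace Λ]
    (ω : Λ → X → X) (hω : Continuous fun q : Λ × X => ω q.1 q.2)
    (p : Measure Λ) [IsProbabilityMeasure p]
    (P : Measure (ℕ → Λ)) (hP : IsBernoulli p P) :
    P (Fset ω) = 1 ↔ P (Sset ω) = 1 := by
  have := hP.1
  have hPeq := hP.eq_infinitePi
  set C := Metric.diam (Set.univ : Set X)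
  let f (n : ℕ) (σ : ℕ → Λ) : ℝ := Metric.diam (Set.range (fcomp ω σ n))
  let g (n : ℕ) (σ : ℕ → Λ) : ℝ := Metric.diam (Set.range (hcomp ω σ n))
  have hf (n) : Measurable (f n) := measurable_diam_fcomp ω hω n
  have hg (n) : Measurable (g n) := measurable_diam_hcomp ω hω n
  have hf0 (n σ) : 0 ≤ f n σ := Metric.diam_nonneg
  have hfC (n σ) : f n σ ≤ C := diam_le_diam_univ _
  have hfint (n) : Integrable (f n) P :=
    .of_bound (hf n).aestronglyMeasurable C (.of_forall fun σ => by
      rw [Real.norm_of_nonneg (hf0 n σ)]; exact hfC n σ)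
  have hgint (n) : Integrable (g n) P :=
    .of_bound (hg n).aestronglyMeasurable C (.of_forall fun σ => by
      rw [Real.norm_of_nonneg Metric.diam_nonneg]; exact diam_le_diam_univ _)
  have hfg (n) : ∫ σ, f n σ ∂P = ∫ σ, g n σ ∂P := by
    have hmp := measurePreserving_reindex (p := p) (revPrefix_injective n)
    rw [← hPeq] at hmp
    conv_lhs => rw [← hmp.map_eq]
    rw [integral_map hmp.measurable.aemeasurable (hf n).aestronglyMeasurable]
    simp only [f, g, hcomp_eq_fcomp_revPrefix]
  have hanti : Antitone fun n => ∫ σ, f n σ ∂P := by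
    simp only [hfg]
    exact fun m n hmn => integral_mono (hgint n) (hgint m) fun σ => diam_hcomp_antitone ω σ hmn
  have hFmeas (n : ℕ) : Measurable fun σ => (n : ℝ)⁻¹ * ∑ i ∈ Finset.range n, f (i + 1) σ :=
    (Finset.measurable_fun_sum _ fun i _ => hf (i + 1)).const_mul _
  have hFset : MeasurableSet (Fset ω) := measurableSet_tendsto _ hFmeas
  have hSset : MeasurableSet (Sset ω) := measurableSet_tendsto _ hg
  rw [← mem_ae_iff_prob_eq_one hFset, ← mem_ae_iff_prob_eq_one hSset]
  have hS : Sset ω ∈ ae P ↔ Tendsto (fun n => ∫ σ, f n σ ∂P) atTop (nhds 0) := by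
    simp only [hfg]
    exact ae_tendsto_zero_iff_of_antitone hg (fun _ _ => Metric.diam_nonneg)
      (fun _ _ => diam_le_diam_univ _) (diam_hcomp_antitone ω)
  rw [hS]
  constructor
  · intro hF
    have hlim := tendsto_integral_of_dominated_convergence (μ := P) (f := fun _ => (0 : ℝ))
      (fun _ => C) (fun n => (hFmeas n).aestronglyMeasurable) (integrable_const C)
      (fun n => .of_forall fun σ => by
        rw [Real.norm_of_nonneg
          (mul_nonneg (by positivity) (Finset.sum_nonneg fun i _ => hf0 _ σ))]
        rcases n.eq_zero_or_pos with rfl | hn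
        · simpa using Metric.diam_nonneg
        rw [inv_mul_le_iff₀ (by exact_mod_cast hn)]
        simpa using Finset.sum_le_card_nsmul (Finset.range n) (fun i => f (i + 1) σ) C
          fun i _ => hfC _ σ) hF
    have heq (n : ℕ) : ∫ σ, (n : ℝ)⁻¹ * ∑ i ∈ Finset.range n, f (i + 1) σ ∂P =
        (n : ℝ)⁻¹ * ∑ i ∈ Finset.range n, ∫ σ, f (i + 1) σ ∂P := by
      rw [integral_const_mul, integral_finsetSum _ fun i _ => hfint (i + 1)]
    simp only [heq, integral_zero] at hlim
    refine tendsto_of_tendsto_of_tendsto_of_le_of_le' tendsto_const_nhds hlim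
      (.of_forall fun n => integral_nonneg (hf0 n)) ?_
    filter_upwards [eventually_gt_atTop 0] with n hn using hanti.le_average hn
  · intro ha
    have hall : ∀ᵐ σ ∂P, ∀ k r : ℕ,
        Tendsto (fun m : ℕ => (∑ j ∈ Finset.range m,
          f (k + 1) fun i => σ (i + (j * (k + 1) + r))) / m)
          atTop (nhds (∫ σ, f (k + 1) σ ∂P)) := by
      rw [ae_all_iff]
      intro k
      rw [ae_all_iff]
      intro r
      have := ae_tendsto_average_windows (p := p) (hf (k + 1)) (hPeq ▸ hfint (k + 1))
        (k := k + 1) (fun σ τ h => by simp only [f, fcomp_congr ω (k + 1) h]) r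
      rwa [← hPeq] at this
    filter_upwards [hall] with σ hσ
    refine tendsto_average_zero_of_window_bounds
      (y := fun i => f (i + 1) σ) (x := fun k i => f (k + 1) fun j => σ (j + i))
      (fun i => hf0 _ σ) (fun i => hfC _ σ) (fun k i => hf0 _ _) (fun k i => ?_)
      ((tendsto_add_atTop_iff_nat 1).2 ha) hσ
    have h := diam_fcomp_add_le ω σ i (k + 1)
    rwa [show i + (k + 1) = k + i + 1 by omega] at h
end

section
/- Let (X,d) and (Λ,ρ) be compact metric spaces, ω : Λ × X → X continuous, and Φ(σ,x) = (β(σ), ω_{σ_1}(x)) the associated skew product on Ω × X, Ω = Λ^ℕ. Let ν be a β-invariant Borel probability measure on Ω with ν(F) = 1, where F = {σ : lim_n (1/n) Σ_{i=1}^n diam(ω_{σ_i} ∘ ⋯ ∘ ω_{σ_1}(X)) = 0}. If ν is ergodic for β and ν^Φ is a Φ-invariant probability measure with π_*(ν^Φ) = ν, then ν^Φ is ergodic for Φ. -/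
open Metric Set Filter MeasureTheory

def shift {Λ : Type*} (σ : ℕ → Λ) : ℕ → Λ := fun n => σ (n + 1)

/-- The skew product `Φ(σ, x) = (β(σ), ω_{σ_1}(x))`. -/
def skew {Λ X : Type*} (ω : Λ → X → X) (q : (ℕ → Λ) × X) : (ℕ → Λ) × X :=
  (shift q.1, ω (q.1 0) q.2)

theorem shift_iterate_apply {Λ : Type*} (σ : ℕ → Λ) (n k : ℕ) :
    shift^[n] σ k = σ (n + k) := by
  induction n generalizing k with
  | zero => simp
  | succ n ih =>
    rw [Function.iterate_succ_apply', shift, ih]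
    congr 1
    omega

theorem skew_iterate_apply {Λ X : Type*} (ω : Λ → X → X) (σ : ℕ → Λ) (x : X) (n : ℕ) :
    (skew ω)^[n] (σ, x) = (shift^[n] σ, fcomp ω σ n x) := by
  induction n with
  | zero => rfl
  | succ n ih =>
    rw [Function.iterate_succ_apply', ih, Function.iterate_succ_apply']
    simp [skew, fcomp, shift_iterate_apply]

theorem measurable_shift {Λ : Type*} [MeasurableSpace Λ] :
    Measurable (shift : (ℕ → Λ) → ℕ → Λ) :=
  measurable_pi_lambda _ fun n => measurable_pi_apply (n + 1)

theorem measurable_skew {Λ X : Type*} [MeasurableSpace Λ] [MeasurableSpace X] {ω : Λ → X → X}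
    (hω : Measurable fun q : Λ × X => ω q.1 q.2) : Measurable (skew ω) :=
  (measurable_shift.comp measurable_fst).prodMk
    (hω.comp (f := fun q : (ℕ → Λ) × X => (q.1 0, q.2))
      (((measurable_pi_apply 0).comp measurable_fst).prodMk measurable_snd))

theorem continuous_fcomp {Λ X : Type*} [TopologicalSpace Λ] [TopologicalSpace X] {ω : Λ → X → X}
    (hω : Continuous fun q : Λ × X => ω q.1 q.2) (n : ℕ) (x : X) :
    Continuous fun σ => fcomp ω σ n x := by
  induction n with
  | zero => exact continuous_const
  | succ n ih => exact hω.comp ((continuous_apply n).prodMk ih)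

theorem measurable_diam_range_fcomp {Λ X : Type*} [MetricSpace X] [CompactSpace X]
    [MetricSpace Λ] [CompactSpace Λ] [MeasurableSpace Λ] [BorelSpace Λ] {ω : Λ → X → X}
    (hω : Continuous fun q : Λ × X => ω q.1 q.2) (n : ℕ) :
    Measurable fun σ => Metric.diam (Set.range (fcomp ω σ n)) := by
  refine measurable_of_Iic fun c => ?_
  rcases lt_or_ge c 0 with hc | hc
  · convert! MeasurableSet.empty
    ext σ
    simpa using hc.trans_le Metric.diam_nonneg
  · have h : (fun σ => Metric.diam (Set.range (fcomp ω σ n))) ⁻¹' Set.Iic c =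
        ⋂ (x : X) (y : X), {σ | dist (fcomp ω σ n x) (fcomp ω σ n y) ≤ c} := by
      ext σ
      simp only [Set.mem_preimage, Set.mem_Iic, Set.mem_iInter, Set.mem_ofPred_eq]
      refine ⟨fun h x y => (Metric.dist_le_diam_of_mem isBounded_of_compactSpace
        (Set.mem_range_self x) (Set.mem_range_self y)).trans h, fun h => ?_⟩
      refine Metric.diam_le_of_forall_dist_le hc ?_
      rintro _ ⟨x, rfl⟩ _ ⟨y, rfl⟩
      exact h x y
    rw [h]
    exact (isClosed_iInter fun x => isClosed_iInter fun y => isClosed_le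
      ((continuous_fcomp hω n x).dist (continuous_fcomp hω n y)) continuous_const).measurableSet

theorem measurableSet_Fset {Λ X : Type*} [MetricSpace X] [CompactSpace X]
    [MetricSpace Λ] [CompactSpace Λ] [MeasurableSpace Λ] [BorelSpace Λ] {ω : Λ → X → X}
    (hω : Continuous fun q : Λ × X => ω q.1 q.2) : MeasurableSet (Fset ω) :=
  measurableSet_tendsto _ fun _ => (Finset.measurable_sum _ fun i _ =>
    measurable_diam_range_fcomp hω (i + 1)).const_mul _

theorem abs_inv_mul_sum_le {C : ℝ} (hC : 0 ≤ C) (n : ℕ) {a : ℕ → ℝ} (ha : ∀ i, |a i| ≤ C) :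
    |(n : ℝ)⁻¹ * ∑ i ∈ Finset.range n, a i| ≤ C := by
  rw [abs_mul, abs_of_nonneg (by positivity : (0 : ℝ) ≤ (n : ℝ)⁻¹)]
  rcases Nat.eq_zero_or_pos n with rfl | hn
  · simpa using hC
  · rw [inv_mul_le_iff₀ (by positivity)]
    refine (Finset.abs_sum_le_sum_abs _ _).trans ((Finset.sum_le_sum fun i _ => ha i).trans ?_)
    simp

/-- The average of `f` over the points `Φ q, …, Φⁿ q` of an orbit of the skew product. -/
noncomputable def orbitAverage {Λ X : Type*} (ω : Λ → X → X) (f : (ℕ → Λ) × X → ℝ) (n : ℕ)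
    (q : (ℕ → Λ) × X) : ℝ :=
  (n : ℝ)⁻¹ * ∑ i ∈ Finset.range n, f ((skew ω)^[i + 1] q)

theorem measurable_orbitAverage {Λ X : Type*} [MeasurableSpace Λ] [MeasurableSpace X]
    {ω : Λ → X → X} (hω : Measurable (skew ω)) {f : (ℕ → Λ) × X → ℝ} (hf : Measurable f) (n : ℕ) :
    Measurable (orbitAverage ω f n) :=
  (Finset.measurable_sum _ fun i _ => hf.comp (hω.iterate (i + 1))).const_mul _

theorem integral_orbitAverage {Λ X : Type*} [MeasurableSpace Λ] [MeasurableSpace X]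
    {ω : Λ → X → X} {μ : Measure ((ℕ → Λ) × X)} (hμ : MeasurePreserving (skew ω) μ μ)
    {f : (ℕ → Λ) × X → ℝ} (hf : Integrable f μ) {n : ℕ} (hn : n ≠ 0) :
    ∫ q, orbitAverage ω f n q ∂μ = ∫ q, f q ∂μ := by
  have h (i : ℕ) : ∫ q, f ((skew ω)^[i + 1] q) ∂μ = ∫ q, f q ∂μ := by
    have hi := hμ.iterate (i + 1)
    rw [← integral_map hi.aemeasurable (by rw [hi.map_eq]; exact hf.aestronglyMeasurable),
      hi.map_eq]
  unfold orbitAverage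
  rw [integral_const_mul, integral_finsetSum (f := fun i q => f ((skew ω)^[i + 1] q)) _
    fun i _ => (hμ.iterate (i + 1)).integrable_comp_of_integrable hf]
  simp only [h, Finset.sum_const, Finset.card_range, nsmul_eq_mul]
  field_simp

theorem abs_orbitAverage_sub_le {Λ X : Type*} [MetricSpace X] [CompactSpace X] (ω : Λ → X → X)
    {f : (ℕ → Λ) × X → ℝ} {K : ℝ} (hK : 0 ≤ K)
    (hf : ∀ σ x y, |f (σ, x) - f (σ, y)| ≤ K * dist x y) (n : ℕ) (σ : ℕ → Λ) (x y : X) :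
    |orbitAverage ω f n (σ, x) - orbitAverage ω f n (σ, y)| ≤
      K * ((n : ℝ)⁻¹ * ∑ i ∈ Finset.range n, Metric.diam (Set.range (fcomp ω σ (i + 1)))) := by
  unfold orbitAverage
  rw [← mul_sub, ← Finset.sum_sub_distrib, abs_mul,
    abs_of_nonneg (by positivity : (0 : ℝ) ≤ (n : ℝ)⁻¹), mul_left_comm, Finset.mul_sum]
  gcongr
  refine (Finset.abs_sum_le_sum_abs _ _).trans (Finset.sum_le_sum fun i _ => ?_)
  rw [skew_iterate_apply, skew_iterate_apply]
  refine (hf _ _ _).trans ?_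
  gcongr
  exact Metric.dist_le_diam_of_mem isBounded_of_compactSpace
    (Set.mem_range_self x) (Set.mem_range_self y)

/-- Orbit averages along a fixed starting point `x₀` determine the integral against any invariant
measure over `ν`. -/
theorem tendsto_integral_orbitAverage {X Λ : Type*} [MetricSpace X] [CompactSpace X]
    [MeasurableSpace X] [MeasurableSpace Λ] {ω : Λ → X → X}
    {ν : Measure (ℕ → Λ)} (hF : ∀ᵐ σ ∂ν, σ ∈ Fset ω)
    {μ : Measure ((ℕ → Λ) × X)} [IsProbabilityMeasure μ]
    (hμ : MeasurePreserving (skew ω) μ μ) (hproj : Measure.map Prod.fst μ = ν)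
    {f : (ℕ → Λ) × X → ℝ} (hfm : Measurable f) {C K : ℝ} (hC : ∀ q, |f q| ≤ C) (hK : 0 ≤ K)
    (hf : ∀ σ x y, |f (σ, x) - f (σ, y)| ≤ K * dist x y) (x₀ : X) :
    Tendsto (fun n => ∫ σ, orbitAverage ω f n (σ, x₀) ∂ν) atTop (nhds (∫ q, f q ∂μ)) := by
  have hC₀ : 0 ≤ C := by
    obtain ⟨q⟩ := nonempty_of_isProbabilityMeasure μ
    exact (abs_nonneg _).trans (hC q)
  have hbound (n : ℕ) (q) : |orbitAverage ω f n q| ≤ C :=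
    abs_inv_mul_sum_le hC₀ n fun i => hC _
  have hmeas := measurable_orbitAverage hμ.measurable hfm
  have hmeas₀ (n : ℕ) : Measurable fun σ => orbitAverage ω f n (σ, x₀) :=
    (hmeas n).comp measurable_prodMk_right
  have hint (n : ℕ) : Integrable (orbitAverage ω f n) μ :=
    .of_bound (hmeas n).aestronglyMeasurable C (.of_forall fun q => hbound n q)
  have hint₀ (n : ℕ) : Integrable (fun q => orbitAverage ω f n (q.1, x₀)) μ :=
    .of_bound ((hmeas₀ n).comp measurable_fst).aestronglyMeasurable C
      (.of_forall fun q => hbound n _)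
  have hdiff : Tendsto (fun n => ∫ q, (orbitAverage ω f n (q.1, x₀) - orbitAverage ω f n q) ∂μ)
      atTop (nhds (∫ _, (0 : ℝ) ∂μ)) := by
    refine tendsto_integral_of_dominated_convergence (fun _ => C + C)
      (fun n => ((hint₀ n).sub (hint n)).aestronglyMeasurable) (integrable_const _)
      (fun n => .of_forall fun q => (abs_sub _ _).trans (add_le_add (hbound n _) (hbound n q))) ?_
    rw [← hproj] at hF
    filter_upwards [ae_of_ae_map measurable_fst.aemeasurable hF] with q hq
    refine squeeze_zero_norm (fun n => abs_orbitAverage_sub_le ω hK hf n q.1 x₀ q.2) ?_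
    simpa using Tendsto.const_mul K hq
  have hfint : Integrable f μ := .of_bound hfm.aestronglyMeasurable C (.of_forall hC)
  have hlim := hdiff.add_const (∫ q, f q ∂μ)
  rw [integral_zero, zero_add] at hlim
  refine hlim.congr' ?_
  filter_upwards [eventually_ne_atTop 0] with n hn
  rw [integral_sub (hint₀ n) (hint n), integral_orbitAverage hμ hfint hn, sub_add_cancel, ← hproj,
    integral_map measurable_fst.aemeasurable (hmeas₀ n).aestronglyMeasurable]

/-- Two finite measures on a product agree if they give the same integrals to products of an
indicator function and a Lipschitz cutoff of a closed set. -/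
theorem ext_of_integral_indicator_thickenedIndicator {Ω X : Type*} [MeasurableSpace Ω]
    [MetricSpace X] [MeasurableSpace X] [BorelSpace X] {μ₁ μ₂ : Measure (Ω × X)}
    [IsFiniteMeasure μ₁] [IsFiniteMeasure μ₂]
    (h : ∀ B : Set Ω, MeasurableSet B → ∀ D : Set X, ∀ δ : ℝ, ∀ hδ : 0 < δ,
      ∫ q, (Prod.fst ⁻¹' B).indicator (fun q => (thickenedIndicator hδ D q.2 : ℝ)) q ∂μ₁ =
      ∫ q, (Prod.fst ⁻¹' B).indicator (fun q => (thickenedIndicator hδ D q.2 : ℝ)) q ∂μ₂) :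
    μ₁ = μ₂ := by
  refine Measure.ext_prod fun {B D} hB hD => ?_
  let fiber (μ : Measure (Ω × X)) : Measure X := (μ.restrict (Prod.fst ⁻¹' B)).map Prod.snd
  have hB' : MeasurableSet (Prod.fst ⁻¹' B : Set (Ω × X)) := measurable_fst hB
  have hfiber (μ : Measure (Ω × X)) {D : Set X} (hD : MeasurableSet D) :
      fiber μ D = μ (B ×ˢ D) := by
    rw [Measure.map_apply measurable_snd hD, Measure.restrict_apply (measurable_snd hD),
      Set.prod_eq, Set.inter_comm]
  have hfiber_int (μ : Measure (Ω × X)) (D : Set X) {δ : ℝ} (hδ : 0 < δ) :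
      ∫ x, (thickenedIndicator hδ D x : ℝ) ∂(fiber μ) =
      ∫ q, (Prod.fst ⁻¹' B).indicator (fun q => (thickenedIndicator hδ D q.2 : ℝ)) q ∂μ := by
    rw [integral_map measurable_snd.aemeasurable, integral_indicator hB']
    exact (NNReal.continuous_coe.comp
      (thickenedIndicator hδ D).continuous).measurable.aestronglyMeasurable
  have hclosed (D : Set X) (hD : IsClosed D) : fiber μ₁ D = fiber μ₂ D := by
    have hlim (μ : Measure (Ω × X)) [IsFiniteMeasure μ] :=
      tendsto_integral_thickenedIndicator_of_isClosed (fiber μ) hD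
        (δs := fun n : ℕ => (1 : ℝ) / (n + 1)) (fun _ => by positivity)
        tendsto_one_div_add_atTop_nhds_zero_nat
    have h₁ := hlim μ₁
    simp only [hfiber_int, h B hB] at h₁
    have h₂ := hlim μ₂
    simp only [hfiber_int] at h₂
    exact (measureReal_eq_measureReal_iff).1 (tendsto_nhds_unique h₁ h₂)
  rw [← hfiber μ₁ hD, ← hfiber μ₂ hD]
  congr 1
  exact ext_of_generate_finite _ (BorelSpace.measurable_eq.trans borel_eq_generateFrom_isClosed)
    isPiSystem_isClosed hclosed (hclosed _ isClosed_univ)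

/-- There is at most one invariant measure of the skew product over `ν`. -/
theorem eq_of_measurePreserving_skew {X Λ : Type*} [MetricSpace X] [CompactSpace X]
    [MeasurableSpace X] [BorelSpace X] [MeasurableSpace Λ] {ω : Λ → X → X}
    {ν : Measure (ℕ → Λ)} (hF : ∀ᵐ σ ∂ν, σ ∈ Fset ω)
    {μ₁ μ₂ : Measure ((ℕ → Λ) × X)} [IsProbabilityMeasure μ₁] [IsProbabilityMeasure μ₂]
    (hμ₁ : MeasurePreserving (skew ω) μ₁ μ₁) (hμ₂ : MeasurePreserving (skew ω) μ₂ μ₂)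
    (hproj₁ : Measure.map Prod.fst μ₁ = ν) (hproj₂ : Measure.map Prod.fst μ₂ = ν) :
    μ₁ = μ₂ := by
  obtain ⟨-, x₀⟩ := nonempty_of_isProbabilityMeasure μ₁
  refine ext_of_integral_indicator_thickenedIndicator fun B hB D δ hδ => ?_
  set f : (ℕ → Λ) × X → ℝ :=
    (Prod.fst ⁻¹' B).indicator fun q => (thickenedIndicator hδ D q.2 : ℝ)
  have hfm : Measurable f :=
    ((NNReal.continuous_coe.comp (thickenedIndicator hδ D).continuous).measurable.comp
      measurable_snd).indicator (measurable_fst hB)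
  have hbound (q) : |f q| ≤ 1 := by
    by_cases hq : q.1 ∈ B
    · simpa [f, hq] using thickenedIndicator_le_one hδ D q.2
    · simp [f, hq]
  have hlip (σ : ℕ → Λ) (x y : X) : |f (σ, x) - f (σ, y)| ≤ (δ.toNNReal⁻¹ : NNReal) * dist x y := by
    by_cases hσ : σ ∈ B
    · simpa [f, hσ, NNReal.dist_eq] using (lipschitzWith_thickenedIndicator hδ D).dist_le_mul x y
    · simpa [f, hσ] using by positivity
  exact tendsto_nhds_unique
    (tendsto_integral_orbitAverage hF hμ₁ hproj₁ hfm hbound NNReal.zero_le_coe hlip x₀)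
    (tendsto_integral_orbitAverage hF hμ₂ hproj₂ hfm hbound NNReal.zero_le_coe hlip x₀)

theorem stmt9 {X Λ : Type*} [MetricSpace X] [CompactSpace X]
    [MeasurableSpace X] [BorelSpace X]
    [MetricSpace Λ] [CompactSpace Λ] [MeasurableSpace Λ] [BorelSpace Λ]
    (ω : Λ → X → X) (hω : Continuous fun q : Λ × X => ω q.1 q.2)
    (ν : Measure (ℕ → Λ)) [IsProbabilityMeasure ν]
    (hF : ν (Fset ω) = 1) (herg : Ergodic shift ν)
    (νΦ : Measure ((ℕ → Λ) × X)) [IsProbabilityMeasure νΦ]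
    (hinv : Measure.map (skew ω) νΦ = νΦ)
    (hproj : Measure.map Prod.fst νΦ = ν) :
    Ergodic (skew ω) νΦ := by
  have hF' : ∀ᵐ σ ∂ν, σ ∈ Fset ω := (mem_ae_iff_prob_eq_one (measurableSet_Fset hω)).2 hF
  have hskew : MeasurePreserving (skew ω) νΦ νΦ := ⟨measurable_skew hω.measurable, hinv⟩
  refine .of_mem_extremePoints (mem_extremePoints_iff_left.2 ⟨⟨hskew, inferInstance⟩, ?_⟩)
  rintro μ₁ ⟨hμ₁, _⟩ μ₂ - ⟨a, b, ha, -, -, hab⟩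
  have hac : μ₁ ≪ νΦ := by
    rw [← hab]
    exact (Measure.absolutelyContinuous_smul ha.ne').trans (.add_right .rfl _)
  have hfst : MeasurePreserving shift (μ₁.map Prod.fst) (μ₁.map Prod.fst) := by
    refine ⟨measurable_shift, ?_⟩
    conv_rhs => rw [← hμ₁.map_eq]
    rw [Measure.map_map measurable_shift measurable_fst,
      Measure.map_map measurable_fst hμ₁.measurable]
    rfl
  have := Measure.isProbabilityMeasure_map (μ := μ₁) measurable_fst.aemeasurable
  have hproj₁ : μ₁.map Prod.fst = ν :=
    herg.eq_of_absolutelyContinuous hfst (hproj ▸ hac.map measurable_fst)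
  exact eq_of_measurePreserving_skew hF' hμ₁ hskew hproj₁ hproj
end
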